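/- Sub-Riemannian Santaló formula: for every f ∈ L¹(ℍ) and every λ > 0, ∫_{ℂ×[0,π/λ²)} I_λ f(z,t) · λ dz dt = 2π ∫_{ℂ×ℝ} f(z,t) dz dt. -/

import Mathlib

noncomputable section

open Complex MeasureTheory Real Set

/-- Heisenberg group multiplication on ℂ × ℝ. -/
def hmul (p q : ℂ × ℝ) : ℂ × ℝ :=
  (p.1 + q.1, p.2 + q.2 + (p.1.re * q.1.im - p.1.im * q.1.re) / 2)

/-- The model sub-Riemannian geodesic of charge `lam`:
`γ_λ(s) = (R e^{i s / R}, s R / 2)` with `R = 1/λ`. -/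
def geo (lam : ℝ) (s : ℝ) : ℂ × ℝ :=
  (((lam : ℂ))⁻¹ * Complex.exp (Complex.I * ((lam * s : ℝ) : ℂ)), s / (2 * lam))

/-- The sub-Riemannian X-ray transform `I_λ f (z,t) = ∫ f((z,t)·γ_λ(s)) ds`. -/
def xray (lam : ℝ) (f : ℂ × ℝ → ℂ) (p : ℂ × ℝ) : ℂ :=
  ∫ s : ℝ, f (hmul p (geo lam s))

lemma continuous_hmul : Continuous fun x : (ℂ × ℝ) × (ℂ × ℝ) => hmul x.1 x.2 := by
  unfold hmul
  fun_prop

lemma continuous_geo (lam : ℝ) : Continuous (geo lam) := by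
  unfold geo
  fun_prop

/-- Lebesgue measure on the Heisenberg group is right-invariant. -/
lemma measurePreserving_hmul_right (q : ℂ × ℝ) :
    MeasurePreserving (fun p => hmul p q) := by
  refine (measurePreserving_add_right (volume : Measure ℂ) q.1).skew_product
    (g := fun z t => t + q.2 + (z.re * q.1.im - z.im * q.1.re) / 2) ?_ ?_
  · fun_prop
  · refine Filter.Eventually.of_forall fun z => ?_
    simp_rw [add_assoc]
    exact (measurePreserving_add_right (volume : Measure ℝ) _).map_eq

lemma integral_comp_hmul_right {f : ℂ × ℝ → ℂ} (hf : AEStronglyMeasurable f) (q : ℂ × ℝ) :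
    ∫ p, f (hmul p q) = ∫ p, f p := by
  have h := measurePreserving_hmul_right q
  conv_rhs => rw [← h.map_eq]
  rw [integral_map h.aemeasurable (h.map_eq.symm ▸ hf)]

/-- Moving along a charge-`lam` geodesic for one period is a vertical translation. -/
lemma hmul_geo_add_period {lam : ℝ} (hlam : lam ≠ 0) (p : ℂ × ℝ) (s : ℝ) (n : ℤ) :
    hmul (p + (0, n * -(π / lam ^ 2))) (geo lam (s + n * (2 * π / lam)))
      = hmul p (geo lam s) := by
  have hexp : Complex.exp (Complex.I * ((lam * (s + n * (2 * π / lam)) : ℝ) : ℂ))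
      = Complex.exp (Complex.I * ((lam * s : ℝ) : ℂ)) := by
    rw [Complex.exp_eq_exp_iff_exists_int]
    refine ⟨n, ?_⟩
    have : (lam : ℂ) ≠ 0 := by exact_mod_cast hlam
    push_cast
    field_simp
  unfold hmul geo
  rw [hexp]
  ext1
  · simp
  · simp only [Prod.snd_add, Prod.fst_add, add_zero]
    field_simp
    ring

/-- The translation `(s, z, t) ↦ (s + 2π/lam, z, t - π/lam²)`, which fixes the endpoint of the
geodesic through `(z, t)` at time `s`. -/
def periodVector (lam : ℝ) : ℝ × (ℂ × ℝ) := (2 * π / lam, (0, -(π / lam ^ 2)))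

lemma zsmul_periodVector_add (lam : ℝ) (n : ℤ) (x : ℝ × (ℂ × ℝ)) :
    n • periodVector lam + x
      = (x.1 + n * (2 * π / lam), x.2 + (0, n * -(π / lam ^ 2))) := by
  ext <;> simp [periodVector, add_comm]

lemma isAddFundamentalDomain_zmultiples {E : Type*} [AddCommGroup E] [MeasurableSpace E]
    {μ : Measure E} {v : E} {D : Set E} (hD : MeasurableSet D)
    (h : ∀ x, ∃! n : ℤ, n • v + x ∈ D) :
    IsAddFundamentalDomain (AddSubgroup.zmultiples v) D μ := by
  refine IsAddFundamentalDomain.mk' hD.nullMeasurableSet fun x => ?_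
  obtain ⟨n, hn, huniq⟩ := h x
  refine ⟨⟨n • v, n, rfl⟩, hn, ?_⟩
  rintro ⟨_, m, rfl⟩ hm
  have := huniq m hm
  subst this
  rfl

lemma isAddLeftInvariant_volume_prod :
    (volume : Measure (ℝ × (ℂ × ℝ))).IsAddLeftInvariant := by
  have : ((volume : Measure ℂ).prod (volume : Measure ℝ)).IsAddLeftInvariant := inferInstance
  exact inferInstanceAs ((volume : Measure ℝ).prod
    ((volume : Measure ℂ).prod (volume : Measure ℝ))).IsAddLeftInvariant

lemma isAddFundamentalDomain_time {lam : ℝ} (hlam : 0 < lam) :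
    IsAddFundamentalDomain (AddSubgroup.zmultiples (periodVector lam))
      (Ico 0 (2 * π / lam) ×ˢ (univ : Set (ℂ × ℝ))) := by
  refine isAddFundamentalDomain_zmultiples (measurableSet_Ico.prod MeasurableSet.univ) fun x => ?_
  have h := existsUnique_add_zsmul_mem_Ico (a := 2 * π / lam) (by positivity) x.1 0
  simp only [zsmul_periodVector_add]
  simpa using h

lemma isAddFundamentalDomain_height {lam : ℝ} (hlam : 0 < lam) :
    IsAddFundamentalDomain (AddSubgroup.zmultiples (periodVector lam))
      ((univ : Set ℝ) ×ˢ ((univ : Set ℂ) ×ˢ Ico 0 (π / lam ^ 2))) := by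
  refine isAddFundamentalDomain_zmultiples
    (MeasurableSet.univ.prod (MeasurableSet.univ.prod measurableSet_Ico)) fun x => ?_
  have h := existsUnique_sub_zsmul_mem_Ico (a := π / lam ^ 2) (by positivity) x.2.2 0
  simp only [zsmul_periodVector_add]
  simpa [sub_eq_add_neg] using h

lemma integrable_comp_hmul_geo {f : ℂ × ℝ → ℂ} (hf : Integrable f) (lam : ℝ)
    (μ : Measure ℝ) [IsFiniteMeasure μ] :
    Integrable (fun x : ℝ × (ℂ × ℝ) => f (hmul x.2 (geo lam x.1))) (μ.prod volume) := by
  have hmp : MeasurePreserving (fun x : ℝ × (ℂ × ℝ) => (x.1, hmul x.2 (geo lam x.1)))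
      (μ.prod volume) (μ.prod volume) := by
    refine (MeasurePreserving.id μ).skew_product (g := fun s p => hmul p (geo lam s)) ?_
      (Filter.Eventually.of_forall fun s => (measurePreserving_hmul_right _).map_eq)
    exact (continuous_hmul.comp
      (continuous_snd.prodMk ((continuous_geo lam).comp continuous_fst))).measurable
  exact hmp.integrable_comp_of_integrable (hf.comp_snd μ)

/-- **Sub-Riemannian Santaló formula:**
`∫_{ℂ×[0,π/λ²)} I_λ f (z,t) λ dz dt = 2π ∫_{ℂ×ℝ} f`. -/
theorem sub_riemannian_santalo (f : ℂ × ℝ → ℂ) (hf : Integrable f)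
    (lam : ℝ) (hlam : 0 < lam) :
    ∫ p in (Set.univ : Set ℂ) ×ˢ Set.Ico (0 : ℝ) (π / lam ^ 2),
        xray lam f p * ((lam : ℝ) : ℂ)
      = ((2 * π : ℝ) : ℂ) * ∫ p : ℂ × ℝ, f p := by
  set F : ℝ × (ℂ × ℝ) → ℂ := fun x => f (hmul x.2 (geo lam x.1))
  have := isAddLeftInvariant_volume_prod
  have hinv : ∀ (g : AddSubgroup.zmultiples (periodVector lam)) x, F (g +ᵥ x) = F x := by
    rintro ⟨_, n, rfl⟩ x
    change F (n • periodVector lam + x) = F x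
    rw [zsmul_periodVector_add]
    exact congrArg f (hmul_geo_add_period hlam.ne' x.2 x.1 n)
  have htime : volume.restrict (Ico 0 (2 * π / lam) ×ˢ (univ : Set (ℂ × ℝ)))
      = (volume.restrict (Ico 0 (2 * π / lam))).prod volume := by
    rw [Measure.volume_eq_prod, ← Measure.prod_restrict, Measure.restrict_univ]
  have hheight : volume.restrict
        ((univ : Set ℝ) ×ˢ ((univ : Set ℂ) ×ˢ Ico 0 (π / lam ^ 2)))
      = (volume : Measure ℝ).prod
        (volume.restrict ((univ : Set ℂ) ×ˢ Ico 0 (π / lam ^ 2))) := by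
    rw [Measure.volume_eq_prod ℝ, ← Measure.prod_restrict, Measure.restrict_univ]
  have hint := integrable_comp_hmul_geo hf lam (volume.restrict (Ico 0 (2 * π / lam)))
  have hint' : IntegrableOn F ((univ : Set ℝ) ×ˢ ((univ : Set ℂ) ×ˢ Ico 0 (π / lam ^ 2))) := by
    rw [← (isAddFundamentalDomain_time hlam).integrableOn_iff
      (isAddFundamentalDomain_height hlam) hinv, IntegrableOn, htime]
    exact hint
  have heq := (isAddFundamentalDomain_time hlam).setIntegral_eq
    (isAddFundamentalDomain_height hlam) hinv
  rw [IntegrableOn, hheight] at hint'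
  rw [htime, hheight, integral_prod _ hint, integral_prod_symm _ hint'] at heq
  simp only [F, integral_comp_hmul_right hf.aestronglyMeasurable] at heq
  rw [integral_mul_const]
  unfold xray
  rw [← heq, setIntegral_const, Measure.real, Real.volume_Ico, sub_zero,
    ENNReal.toReal_ofReal (by positivity), Complex.real_smul]
  have : (lam : ℂ) ≠ 0 := by exact_mod_cast hlam.ne'
  push_cast
  field_simp

end
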